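/- Let N ≥ 2 and let H be an H-matrix satisfying the H-invariance conditions P(N−1,m;H) = (1/N)·C(N,m+1) for m = 1,…,N−1. Then for every real inner product space V, every y₀ ∈ V and all vectors g₁,…,g_N ∈ V, defining y_i = y_{i−1} − Σ_{j=1}^{i} 2h_{i,j}·g_j for i = 1,…,N−1 and x_i = y_{i−1} − g_i for i = 1,…,N, the identity 0 = N·‖g_N‖² + ⟨g_N, x_N − y₀⟩ + Σ_{k=1}^{N} Σ_{j=1}^{k−1} λ*_{k,j}(H)·⟨x_k − x_j, g_k − g_j⟩ holds. Moreover, (λ*_{k,j}(H))_{1 ≤ j < k ≤ N} is the unique family of real numbers (λ_{k,j}) for which this identity (with λ_{k,j} in place of λ*_{k,j}(H)) holds for all choices of y₀, g₁,…,g_N ∈ ℝ^{N+1}. -/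

import Mathlib

open Finset

/-- `Pinv H k m` is `P(k,m;H)`: the sum over all index sequences
`1 ≤ j(1) ≤ i(1) < j(2) ≤ i(2) < ⋯ < j(m) ≤ i(m) ≤ k` of `∏_{r} h_{i(r),j(r)}`,
with `P(k,0;H) = 1`. -/
noncomputable def Pinv (H : ℕ → ℕ → ℝ) (k : ℕ) : ℕ → ℝ
  | 0 => 1
  | m + 1 =>
    ∑ f : Fin (m + 1) → Fin (k + 1) × Fin (k + 1),
      if (∀ r, 1 ≤ ((f r).2 : ℕ) ∧ ((f r).2 : ℕ) ≤ ((f r).1 : ℕ)) ∧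
          (∀ r : Fin m, ((f r.castSucc).1 : ℕ) < ((f r.succ).2 : ℕ)) then
        ∏ r, H ((f r).1 : ℕ) ((f r).2 : ℕ)
      else 0

/-- `Qinv H k m j` is `Q(k,m,j;H)`: the partial sum of `P(k,m;H)` over those index
sequences with `j(1) = j` (zero if no such sequence exists, and zero for `m = 0`). -/
noncomputable def Qinv (H : ℕ → ℕ → ℝ) (k : ℕ) : ℕ → ℕ → ℝ
  | 0, _ => 0
  | m + 1, j =>
    ∑ f : Fin (m + 1) → Fin (k + 1) × Fin (k + 1),
      if (∀ r, 1 ≤ ((f r).2 : ℕ) ∧ ((f r).2 : ℕ) ≤ ((f r).1 : ℕ)) ∧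
          (∀ r : Fin m, ((f r.castSucc).1 : ℕ) < ((f r.succ).2 : ℕ)) ∧
          ((f 0).2 : ℕ) = j then
        ∏ r, H ((f r).1 : ℕ) ((f r).2 : ℕ)
      else 0

/-- The H-certificates `λ*_{k,j}(H)`:
`λ*_{N,j}(H) = N·Σ_{m=1}^{N−j} (−1)^{m−1}·Q(N−1,m,j;H)` for `j = 1,…,N−1`, and
`λ*_{k,j}(H) = N·Σ_{ℓ=1}^{N−j} Σ_{m=1}^{N−k} (−1)^{ℓ+m−1}·C(ℓ+m,m)·Q(N−1,ℓ,j;H)·Q(N−1,m,k;H)`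
for `1 ≤ j < k ≤ N−1`. -/
noncomputable def lamStar (N : ℕ) (H : ℕ → ℕ → ℝ) (k j : ℕ) : ℝ :=
  if k = N then
    (N : ℝ) * ∑ m ∈ Finset.Icc 1 (N - j), (-1 : ℝ) ^ (m - 1) * Qinv H (N - 1) m j
  else
    (N : ℝ) * ∑ l ∈ Finset.Icc 1 (N - j), ∑ m ∈ Finset.Icc 1 (N - k),
      (-1 : ℝ) ^ (l + m - 1) * (Nat.choose (l + m) m : ℝ) *
        Qinv H (N - 1) l j * Qinv H (N - 1) m k

open scoped RealInnerProductSpace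

/-- The strictly lower triangular matrix `A` with `x_k - y₀ = -g_k - 2 ∑ i, A k i • g_i`. -/
noncomputable def partialColSum (H : ℕ → ℕ → ℝ) (i j : ℕ) : ℝ := ∑ t ∈ Finset.Ico j i, H t j

/-- The entry `(N, j)` of the `m`-th power of `partialColSum H`. -/
noncomputable def lastRowPow (N : ℕ) (H : ℕ → ℕ → ℝ) : ℕ → ℕ → ℝ
  | 0, j => if j = N then 1 else 0
  | m + 1, j => ∑ i ∈ Finset.Icc 1 N, lastRowPow N H m i * partialColSum H i j

theorem partialColSum_eq_zero (H : ℕ → ℕ → ℝ) {i j : ℕ} (h : i ≤ j) :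
    partialColSum H i j = 0 := by
  simp [partialColSum, Finset.Ico_eq_empty_of_le h]

theorem lastRowPow_eq_zero (N : ℕ) (H : ℕ → ℕ → ℝ) (m : ℕ) :
    ∀ j, N < m + j → lastRowPow N H m j = 0 := by
  induction m with
  | zero => intro j hj; simp [lastRowPow]; omega
  | succ m ih =>
    intro j hj
    refine Finset.sum_eq_zero fun i _ => ?_
    rcases le_or_gt i j with h | h
    · rw [partialColSum_eq_zero H h, mul_zero]
    · rw [ih i (by omega), zero_mul]

/-- The summand of `Pinv`. -/
noncomputable def chainWeight (H : ℕ → ℕ → ℝ) (k m : ℕ)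
    (f : Fin (m + 1) → Fin (k + 1) × Fin (k + 1)) : ℝ :=
  if (∀ r, 1 ≤ ((f r).2 : ℕ) ∧ ((f r).2 : ℕ) ≤ ((f r).1 : ℕ)) ∧
      (∀ r : Fin m, ((f r.castSucc).1 : ℕ) < ((f r.succ).2 : ℕ)) then
    ∏ r, H ((f r).1 : ℕ) ((f r).2 : ℕ)
  else 0

theorem Qinv_succ_eq_sum_chainWeight (H : ℕ → ℕ → ℝ) (k m j : ℕ) :
    Qinv H k (m + 1) j =
      ∑ f : Fin (m + 1) → Fin (k + 1) × Fin (k + 1),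
        if ((f 0).2 : ℕ) = j then chainWeight H k m f else 0 := by
  rw [Qinv]
  refine Finset.sum_congr rfl fun f _ => ?_
  unfold chainWeight
  split_ifs <;> first | rfl | tauto

theorem chainWeight_eq_zero (H : ℕ → ℕ → ℝ) (k m : ℕ)
    (f : Fin (m + 1) → Fin (k + 1) × Fin (k + 1)) (h : ((f 0).2 : ℕ) = 0) :
    chainWeight H k m f = 0 := by
  refine if_neg fun hf => ?_
  have := (hf.1 0).1
  omega

theorem sum_Qinv_succ (H : ℕ → ℕ → ℝ) (k m : ℕ) (F : ℕ → ℝ) (N : ℕ) (hN : k + 1 = N) :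
    ∑ j ∈ Finset.Icc 1 N, Qinv H k (m + 1) j * F j =
      ∑ f : Fin (m + 1) → Fin (k + 1) × Fin (k + 1), chainWeight H k m f * F (f 0).2 := by
  simp_rw [Qinv_succ_eq_sum_chainWeight, Finset.sum_mul]
  rw [Finset.sum_comm]
  refine Finset.sum_congr rfl fun f _ => ?_
  by_cases h : ((f 0).2 : ℕ) = 0
  · simp [chainWeight_eq_zero H k m f h]
  · rw [Finset.sum_eq_single_of_mem ((f 0).2 : ℕ)]
    · simp
    · have := (f 0).2.isLt
      rw [Finset.mem_Icc]; omega
    · intro b _ hb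
      rw [if_neg (Ne.symm hb), zero_mul]

theorem Pinv_succ_eq_sum_Qinv (H : ℕ → ℕ → ℝ) (k m N : ℕ) (hN : k + 1 = N) :
    Pinv H k (m + 1) = ∑ j ∈ Finset.Icc 1 N, Qinv H k (m + 1) j := by
  have := sum_Qinv_succ H k m (fun _ => 1) N hN
  simp only [mul_one] at this
  rw [this, Pinv]
  rfl

theorem chainWeight_cons (H : ℕ → ℕ → ℝ) (k m : ℕ) (a : Fin (k + 1) × Fin (k + 1))
    (f : Fin (m + 1) → Fin (k + 1) × Fin (k + 1)) :
    chainWeight H k (m + 1) (Fin.cons a f) =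
      (if 1 ≤ (a.2 : ℕ) ∧ (a.2 : ℕ) ≤ a.1 ∧ (a.1 : ℕ) < (f 0).2 then H a.1 a.2 else 0) *
        chainWeight H k m f := by
  unfold chainWeight
  rw [ite_mul, mul_ite, zero_mul, mul_zero, ← ite_and]
  refine if_congr ?_ ?_ rfl
  · rw [Fin.forall_fin_succ]
    rw [Fin.forall_fin_succ (P := fun r : Fin (m + 1) =>
      ((Fin.cons a f : Fin (m + 2) → _) r.castSucc).1.val <
        ((Fin.cons a f : Fin (m + 2) → _) r.succ).2.val)]
    simp only [Fin.cons_zero, Fin.cons_succ, Fin.castSucc_zero, ← Fin.succ_castSucc]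
    tauto
  · rw [Fin.prod_univ_succ]
    simp

theorem sum_prod_fin_ite (H : ℕ → ℕ → ℝ) (k j b : ℕ) (hj : 1 ≤ j) (hb : b ≤ k + 1) :
    ∑ a : Fin (k + 1) × Fin (k + 1),
      (if (a.2 : ℕ) = j then
        (if 1 ≤ (a.2 : ℕ) ∧ (a.2 : ℕ) ≤ a.1 ∧ (a.1 : ℕ) < b then H a.1 a.2 else 0) else 0) =
      partialColSum H b j := by
  rw [Fintype.sum_prod_type]
  have h1 : ∀ x : Fin (k + 1), (∑ y : Fin (k + 1), if (y : ℕ) = j then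
      (if 1 ≤ (y : ℕ) ∧ (y : ℕ) ≤ x ∧ (x : ℕ) < b then H x y else 0) else 0) =
      if j ≤ (x : ℕ) ∧ (x : ℕ) < b then H x j else 0 := by
    intro x
    by_cases hjk : j ≤ k
    · rw [Finset.sum_eq_single_of_mem (⟨j, by omega⟩ : Fin (k + 1)) (Finset.mem_univ _)]
      · simp [hj]
      · intro y _ hy
        rw [if_neg fun h => hy (Fin.ext h)]
    · rw [Finset.sum_eq_zero, if_neg (by omega)]
      intro y _
      rw [if_neg (by omega)]
  simp_rw [h1]
  rw [Fin.sum_univ_eq_sum_range (fun x => if j ≤ x ∧ x < b then H x j else 0) (k + 1),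
    ← Finset.sum_filter, partialColSum]
  refine Finset.sum_congr ?_ fun _ _ => rfl
  ext x
  simp only [Finset.mem_filter, Finset.mem_range, Finset.mem_Ico]
  omega

theorem Qinv_one (H : ℕ → ℕ → ℝ) (k j : ℕ) (hj : 1 ≤ j) :
    Qinv H k 1 j = partialColSum H (k + 1) j := by
  rw [Qinv_succ_eq_sum_chainWeight, ← sum_prod_fin_ite H k j (k + 1) hj le_rfl]
  rw [← (Equiv.funUnique (Fin 1) (Fin (k + 1) × Fin (k + 1))).sum_comp]
  refine Finset.sum_congr rfl fun f _ => ?_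
  have h : ((f 0).1 : ℕ) ≤ k := Nat.lt_succ_iff.1 (f 0).1.isLt
  simp [chainWeight, h]

theorem Qinv_succ_succ (H : ℕ → ℕ → ℝ) (k m j N : ℕ) (hN : k + 1 = N) (hj : 1 ≤ j) :
    Qinv H k (m + 2) j =
      ∑ i ∈ Finset.Icc 1 N, Qinv H k (m + 1) i * partialColSum H i j := by
  rw [sum_Qinv_succ H k m (fun i => partialColSum H i j) N hN, Qinv_succ_eq_sum_chainWeight,
    ← (Fin.consEquiv fun _ => Fin (k + 1) × Fin (k + 1)).sum_comp, Fintype.sum_prod_type,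
    Finset.sum_comm]
  refine Finset.sum_congr rfl fun f _ => ?_
  rw [← sum_prod_fin_ite H k j (f 0).2 hj (f 0).2.isLt.le, Finset.mul_sum]
  refine Finset.sum_congr rfl fun a _ => ?_
  rw [Fin.consEquiv_apply, Fin.cons_zero]
  change (if (a.2 : ℕ) = j then chainWeight H k (m + 1) (Fin.cons a f) else 0) = _
  rw [chainWeight_cons]
  split_ifs <;> ring

theorem Qinv_eq_lastRowPow (H : ℕ → ℕ → ℝ) (k N : ℕ) (hN : k + 1 = N) (m : ℕ) :
    ∀ j, 1 ≤ j → Qinv H k (m + 1) j = lastRowPow N H (m + 1) j := by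
  induction m with
  | zero =>
    intro j hj
    rw [Qinv_one H k j hj, hN]
    simp only [lastRowPow, ite_mul, one_mul, zero_mul]
    rw [Finset.sum_ite_eq' (Finset.Icc 1 N), if_pos (Finset.mem_Icc.2 (by omega))]
  | succ m ih =>
    intro j hj
    rw [Qinv_succ_succ H k m j N hN hj, lastRowPow]
    refine Finset.sum_congr rfl fun i hi => ?_
    rw [ih i (Finset.mem_Icc.1 hi).1]

theorem sum_lastRowPow (H : ℕ → ℕ → ℝ) (k N : ℕ) (hN : k + 1 = N) (m : ℕ) :
    ∑ j ∈ Finset.Icc 1 N, lastRowPow N H m j = Pinv H k m := by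
  cases m with
  | zero => simp [lastRowPow, Pinv]; omega
  | succ m =>
    rw [Pinv_succ_eq_sum_Qinv H k m N hN]
    exact Finset.sum_congr rfl fun j hj =>
      (Qinv_eq_lastRowPow H k N hN m j (Finset.mem_Icc.1 hj).1).symm

/-- The coefficients `(-1)^(l+m) C(l+m, m)` of `1 / (1 + X + Y)`. -/
noncomputable def signedChoose (l m : ℕ) : ℝ := (-1) ^ (l + m) * ((l + m).choose m : ℝ)

theorem signedChoose_comm (l m : ℕ) : signedChoose l m = signedChoose m l := by
  unfold signedChoose
  rw [add_comm m l, Nat.choose_symm_add]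

theorem signedChoose_zero_right (l : ℕ) : signedChoose l 0 = (-1) ^ l := by
  simp [signedChoose]

theorem signedChoose_succ_succ (l m : ℕ) :
    signedChoose (l + 1) (m + 1) + signedChoose l (m + 1) + signedChoose (l + 1) m = 0 := by
  unfold signedChoose
  have h : (l + 1 + (m + 1)).choose (m + 1) =
      (l + 1 + m).choose m + (l + (m + 1)).choose (m + 1) := by
    rw [show l + 1 + (m + 1) = (l + 1 + m) + 1 by ring, Nat.choose_succ_succ,
      show l + 1 + m = l + (m + 1) by ring]
  rw [h]
  push_cast
  ring

theorem sum_signedChoose_recurrence (N : ℕ) (hN : 1 ≤ N) (u v : ℕ → ℝ) (hu : u N = 0)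
    (hv : v N = 0) :
    (∑ l ∈ Finset.range N, ∑ m ∈ Finset.range N, signedChoose l m * u l * v m) +
      (∑ l ∈ Finset.range N, ∑ m ∈ Finset.range N, signedChoose l m * u (l + 1) * v m) +
      (∑ l ∈ Finset.range N, ∑ m ∈ Finset.range N, signedChoose l m * u l * v (m + 1)) =
      u 0 * v 0 := by
  obtain ⟨n, rfl⟩ : ∃ n, N = n + 1 := ⟨N - 1, by omega⟩
  have h1 : ∀ m, ∑ l ∈ Finset.range (n + 1), signedChoose l m * u (l + 1) * v m =
      ∑ l ∈ Finset.range n, signedChoose l m * u (l + 1) * v m := by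
    intro m; rw [Finset.sum_range_succ, hu]; ring
  have h2 : ∀ l, ∑ m ∈ Finset.range (n + 1), signedChoose l m * u l * v (m + 1) =
      ∑ m ∈ Finset.range n, signedChoose l m * u l * v (m + 1) := by
    intro l; rw [Finset.sum_range_succ, hv]; ring
  simp_rw [h2]
  rw [Finset.sum_comm (s := Finset.range (n + 1)) (t := Finset.range (n + 1))
    (f := fun l m => signedChoose l m * u (l + 1) * v m)]
  simp_rw [h1]
  rw [Finset.sum_comm (s := Finset.range (n + 1)) (t := Finset.range n)
    (f := fun m l => signedChoose l m * u (l + 1) * v m)]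
  simp only [Finset.sum_range_succ', Finset.sum_add_distrib]
  have h3 : (∑ l ∈ Finset.range n, ∑ m ∈ Finset.range n,
        signedChoose (l + 1) (m + 1) * u (l + 1) * v (m + 1)) +
      (∑ l ∈ Finset.range n, ∑ m ∈ Finset.range n,
        signedChoose l (m + 1) * u (l + 1) * v (m + 1)) +
      (∑ l ∈ Finset.range n, ∑ m ∈ Finset.range n,
        signedChoose (l + 1) m * u (l + 1) * v (m + 1)) = 0 := by
    simp only [← Finset.sum_add_distrib]
    refine Finset.sum_eq_zero fun l _ => Finset.sum_eq_zero fun m _ => ?_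
    rw [← add_mul, ← add_mul, ← add_mul, ← add_mul, signedChoose_succ_succ]
    ring
  have h4 : ∀ l, signedChoose (l + 1) 0 = - signedChoose l 0 := by
    intro l; simp only [signedChoose_zero_right]; ring
  have h5 : ∀ l, signedChoose 0 (l + 1) = - signedChoose 0 l := by
    intro l; rw [signedChoose_comm, h4, signedChoose_comm]
  have h6 : signedChoose 0 0 = 1 := by simp [signedChoose]
  simp only [h4, h5, h6, neg_mul, Finset.sum_neg_distrib]
  linarith

theorem sum_signedChoose_mul_choose (N m : ℕ) (hm : m < N) :
    ∑ l ∈ Finset.range N, signedChoose l m * (N.choose (l + 1) : ℝ) = if m = 0 then 1 else 0 := by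
  cases m with
  | zero =>
    have h := Int.alternating_sum_range_choose_of_ne (n := N) (by omega)
    rw [Finset.sum_range_succ'] at h
    have h' : ∑ l ∈ Finset.range N, ((-1 : ℝ)) ^ (l + 1) * (N.choose (l + 1) : ℝ) + 1 = 0 := by
      have := congrArg (Int.cast : ℤ → ℝ) h
      push_cast at this
      simpa using this
    simp only [signedChoose_zero_right, if_true]
    simp only [pow_succ, mul_neg, mul_one, neg_mul, Finset.sum_neg_distrib] at h'
    linarith
  | succ m =>
    have h0 : (fwdDiff (1 : ℕ))^[N] (fun x : ℕ => ((x.choose (m + 1) : ℕ) : ℤ)) m = 0 := by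
      obtain ⟨d, rfl⟩ := Nat.exists_eq_add_of_lt hm
      rw [show m + 1 + d + 1 = d + 1 + (m + 1) by ring, Function.iterate_add_apply,
        show m + 1 = m + 1 + 0 by ring, fwdDiff_iter_choose 0 (m + 1)]
      simp_rw [Nat.choose_zero_right, Function.iterate_succ_apply, Nat.cast_one, fwdDiff_const,
        fwdDiff_iter_eq_sum_shift, smul_zero, Finset.sum_const_zero]
    rw [fwdDiff_iter_eq_sum_shift, Finset.sum_range_succ'] at h0
    have h' := congrArg (Int.cast : ℤ → ℝ) h0
    push_cast at h'
    simp only [smul_eq_mul, mul_one, add_zero, Nat.choose_succ_self, Nat.cast_zero,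
      mul_zero, Int.cast_zero] at h'
    rw [if_neg (by omega)]
    have h'' := congrArg (fun t => (-1 : ℝ) ^ (N + m) * t) h'
    simp only [mul_zero] at h''
    rw [← h'', Finset.mul_sum]
    refine Finset.sum_congr rfl fun l hl => ?_
    have hl := Finset.mem_range.1 hl
    obtain ⟨d, rfl⟩ : ∃ d, N = l + 1 + d := ⟨N - (l + 1), by omega⟩
    push_cast
    rw [signedChoose, show l + 1 + d - (l + 1) = d by omega, show l + (m + 1) = m + (l + 1) by ring,
      show l + 1 + d + m = (m + (l + 1)) + d by ring, pow_add _ _ d]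
    have hd : (-1 : ℝ) ^ d * (-1) ^ d = 1 := by rw [← mul_pow]; simp
    linear_combination (-(-1 : ℝ) ^ (m + (l + 1)) * ((m + (l + 1)).choose (m + 1) : ℝ) *
      ((l + 1 + d).choose (l + 1) : ℝ)) * hd

/-- The symmetric solution `M` of the Lyapunov equation `M + M A + Aᵀ M = N e_N e_Nᵀ`. -/
noncomputable def lyapunovSol (N : ℕ) (H : ℕ → ℕ → ℝ) (k j : ℕ) : ℝ :=
  (N : ℝ) * ∑ l ∈ Finset.range N, ∑ m ∈ Finset.range N,
    signedChoose l m * lastRowPow N H l j * lastRowPow N H m k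

theorem lyapunovSol_comm (N : ℕ) (H : ℕ → ℕ → ℝ) (k j : ℕ) :
    lyapunovSol N H k j = lyapunovSol N H j k := by
  unfold lyapunovSol
  rw [Finset.sum_comm]
  congr 1
  refine Finset.sum_congr rfl fun l _ => Finset.sum_congr rfl fun m _ => ?_
  rw [signedChoose_comm]
  ring

theorem sum_lyapunovSol_mul (N : ℕ) (H : ℕ → ℕ → ℝ) (k j : ℕ) :
    ∑ i ∈ Finset.Icc 1 N, lyapunovSol N H k i * partialColSum H i j =
      (N : ℝ) * ∑ l ∈ Finset.range N, ∑ m ∈ Finset.range N,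
        signedChoose l m * lastRowPow N H (l + 1) j * lastRowPow N H m k := by
  simp only [lyapunovSol, lastRowPow, Finset.mul_sum, Finset.sum_mul]
  rw [Finset.sum_comm]
  refine Finset.sum_congr rfl fun l _ => ?_
  rw [Finset.sum_comm]
  refine Finset.sum_congr rfl fun m _ => Finset.sum_congr rfl fun i _ => ?_
  ring

theorem lyapunovSol_equation (N : ℕ) (hN : 1 ≤ N) (H : ℕ → ℕ → ℝ) (k j : ℕ) (hk : 1 ≤ k)
    (hj : 1 ≤ j) :
    lyapunovSol N H k j + ∑ i ∈ Finset.Icc 1 N, lyapunovSol N H k i * partialColSum H i j +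
      ∑ i ∈ Finset.Icc 1 N, partialColSum H i k * lyapunovSol N H i j =
      if k = N ∧ j = N then (N : ℝ) else 0 := by
  have h2 : ∑ i ∈ Finset.Icc 1 N, partialColSum H i k * lyapunovSol N H i j =
      (N : ℝ) * ∑ l ∈ Finset.range N, ∑ m ∈ Finset.range N,
        signedChoose l m * lastRowPow N H l j * lastRowPow N H (m + 1) k := by
    have h := sum_lyapunovSol_mul N H j k
    rw [Finset.sum_comm] at h
    rw [Finset.sum_congr rfl fun i _ => by rw [mul_comm, lyapunovSol_comm], h]
    congr 1
    refine Finset.sum_congr rfl fun l _ => Finset.sum_congr rfl fun m _ => ?_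
    rw [signedChoose_comm]
    ring
  rw [sum_lyapunovSol_mul, h2, lyapunovSol, ← mul_add, ← mul_add,
    sum_signedChoose_recurrence N hN (fun l => lastRowPow N H l j) (fun m => lastRowPow N H m k)
      (lastRowPow_eq_zero N H N j (by omega)) (lastRowPow_eq_zero N H N k (by omega))]
  simp only [lastRowPow]
  split_ifs <;> first | omega | simp

theorem sum_lyapunovSol (N : ℕ) (hN : 1 ≤ N) (H : ℕ → ℕ → ℝ)
    (hinv : ∀ m, 1 ≤ m → m ≤ N - 1 →
      Pinv H (N - 1) m = 1 / (N : ℝ) * (Nat.choose N (m + 1) : ℝ)) (k : ℕ) :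
    ∑ j ∈ Finset.Icc 1 N, lyapunovSol N H k j = if k = N then 1 else 0 := by
  have hN0 : (N : ℝ) ≠ 0 := by positivity
  have hP : ∀ l ∈ Finset.range N, (N : ℝ) * ∑ j ∈ Finset.Icc 1 N, lastRowPow N H l j =
      (N.choose (l + 1) : ℝ) := by
    intro l hl
    have hl := Finset.mem_range.1 hl
    rw [sum_lastRowPow H (N - 1) N (by omega)]
    rcases Nat.eq_zero_or_pos l with rfl | hl0
    · simp [Pinv]
    · rw [hinv l hl0 (by omega)]
      field_simp
  calc ∑ j ∈ Finset.Icc 1 N, lyapunovSol N H k j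
      = ∑ l ∈ Finset.range N, ∑ m ∈ Finset.range N, signedChoose l m *
          ((N : ℝ) * ∑ j ∈ Finset.Icc 1 N, lastRowPow N H l j) * lastRowPow N H m k := by
        simp only [lyapunovSol, Finset.mul_sum, Finset.sum_mul]
        rw [Finset.sum_comm]
        refine Finset.sum_congr rfl fun l _ => ?_
        rw [Finset.sum_comm]
        refine Finset.sum_congr rfl fun m _ => Finset.sum_congr rfl fun i _ => ?_
        ring
    _ = ∑ l ∈ Finset.range N, ∑ m ∈ Finset.range N, signedChoose l m *
          (N.choose (l + 1) : ℝ) * lastRowPow N H m k :=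
        Finset.sum_congr rfl fun l hl => by rw [hP l hl]
    _ = ∑ m ∈ Finset.range N, (if m = 0 then 1 else 0) * lastRowPow N H m k := by
        rw [Finset.sum_comm]
        refine Finset.sum_congr rfl fun m hm => ?_
        rw [← Finset.sum_mul, sum_signedChoose_mul_choose N m (Finset.mem_range.1 hm)]
    _ = if k = N then 1 else 0 := by
        simp only [ite_mul, one_mul, zero_mul]
        rw [Finset.sum_ite_eq' (Finset.range N), if_pos (Finset.mem_range.2 hN), lastRowPow]

theorem sum_range_lastRowPow (N : ℕ) (H : ℕ → ℕ → ℝ) (j : ℕ) (hj : 1 ≤ j) (hjN : j < N)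
    (c : ℕ → ℝ) :
    ∑ l ∈ Finset.range N, c l * lastRowPow N H l j =
      ∑ l ∈ Finset.Icc 1 (N - j), c l * Qinv H (N - 1) l j := by
  symm
  calc ∑ l ∈ Finset.Icc 1 (N - j), c l * Qinv H (N - 1) l j
      = ∑ l ∈ Finset.Icc 1 (N - j), c l * lastRowPow N H l j := by
        refine Finset.sum_congr rfl fun l hl => ?_
        obtain ⟨l, rfl⟩ : ∃ l', l = l' + 1 := ⟨l - 1, by grind⟩
        rw [Qinv_eq_lastRowPow H (N - 1) N (by omega) l j hj]
    _ = _ := by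
        refine Finset.sum_subset (fun l hl => ?_) fun l hl hl' => ?_
        · rw [Finset.mem_Icc] at hl
          rw [Finset.mem_range]
          omega
        · rw [Finset.mem_Icc] at hl'
          rcases Nat.eq_zero_or_pos l with rfl | hl0
          · rw [lastRowPow, if_neg hjN.ne, mul_zero]
          · rw [lastRowPow_eq_zero N H l j (by omega), mul_zero]

theorem lamStar_eq_neg_lyapunovSol (N : ℕ) (H : ℕ → ℕ → ℝ) (k j : ℕ) (hj : 1 ≤ j) (hjk : j < k)
    (hkN : k ≤ N) : lamStar N H k j = -lyapunovSol N H k j := by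
  have hsplit : lyapunovSol N H k j = (N : ℝ) * ∑ l ∈ Finset.range N,
      (∑ m ∈ Finset.range N, signedChoose l m * lastRowPow N H m k) * lastRowPow N H l j := by
    simp only [lyapunovSol, Finset.sum_mul]
    congr 1
    refine Finset.sum_congr rfl fun l _ => Finset.sum_congr rfl fun m _ => ?_
    ring
  rw [hsplit, sum_range_lastRowPow N H j hj (by omega), lamStar, ← mul_neg,
    ← Finset.sum_neg_distrib]
  split_ifs with h
  · subst h
    congr 1
    refine Finset.sum_congr rfl fun l hl => ?_
    have h0 : ∑ m ∈ Finset.range k, signedChoose l m * lastRowPow k H m k = (-1) ^ l := by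
      rw [Finset.sum_eq_single_of_mem 0 (Finset.mem_range.2 (by omega))]
      · simp [signedChoose_zero_right, lastRowPow]
      · intro m _ hm
        rw [lastRowPow_eq_zero k H m k (by omega), mul_zero]
    obtain ⟨l, rfl⟩ : ∃ l', l = l' + 1 := ⟨l - 1, by grind⟩
    rw [h0, Nat.add_sub_cancel]
    ring
  · congr 1
    refine Finset.sum_congr rfl fun l hl => ?_
    obtain ⟨l, rfl⟩ : ∃ l', l = l' + 1 := ⟨l - 1, by grind⟩
    rw [sum_range_lastRowPow N H k (by omega) (by omega), ← neg_mul, ← Finset.sum_neg_distrib,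
      Finset.sum_mul]
    refine Finset.sum_congr rfl fun m _ => ?_
    rw [signedChoose, show l + 1 + m - 1 = l + m by omega]
    ring

theorem lyapunov_unique (N : ℕ) (A D : ℕ → ℕ → ℝ) (hA : ∀ i j, i ≤ j → A i j = 0)
    (hD : ∀ i ∈ Finset.Icc 1 N, ∀ j ∈ Finset.Icc 1 N, D i j +
      ∑ l ∈ Finset.Icc 1 N, D i l * A l j + ∑ l ∈ Finset.Icc 1 N, A l i * D l j = 0) :
    ∀ i ∈ Finset.Icc 1 N, ∀ j ∈ Finset.Icc 1 N, D i j = 0 := by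
  suffices h : ∀ n, ∀ i ∈ Finset.Icc 1 N, ∀ j ∈ Finset.Icc 1 N, 2 * N < i + j + n → D i j = 0 from
    fun i hi j hj => h (2 * N + 1) i hi j hj (by omega)
  intro n
  induction n with
  | zero => intro i hi j hj h; simp only [Finset.mem_Icc] at hi hj; omega
  | succ n ih =>
    intro i hi j hj h
    have h1 : ∑ l ∈ Finset.Icc 1 N, D i l * A l j = 0 := Finset.sum_eq_zero fun l hl => by
      rcases le_or_gt l j with h' | h'
      · rw [hA l j h', mul_zero]
      · rw [ih i hi l hl (by omega), zero_mul]
    have h2 : ∑ l ∈ Finset.Icc 1 N, A l i * D l j = 0 := Finset.sum_eq_zero fun l hl => by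
      rcases le_or_gt l i with h' | h'
      · rw [hA l i h', zero_mul]
      · rw [ih l hl j hj (by omega), mul_zero]
    simpa [h1, h2] using hD i hi j hj

theorem two_mul_sum_lower_triangle (N : ℕ) (F : ℕ → ℕ → ℝ) (hF : ∀ i j, F i j = F j i)
    (hd : ∀ i, F i i = 0) :
    2 * ∑ k ∈ Finset.Icc 1 N, ∑ j ∈ Finset.Icc 1 (k - 1), F k j =
      ∑ k ∈ Finset.Icc 1 N, ∑ j ∈ Finset.Icc 1 N, F k j := by
  induction N with
  | zero => simp
  | succ N ih =>
    simp only [Finset.sum_Icc_succ_top (Nat.le_add_left 1 N), Finset.sum_add_distrib,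
      Nat.add_sub_cancel, hd, mul_add, ih]
    rw [Finset.sum_congr rfl fun k _ => hF k (N + 1)]
    ring

section InnerProduct

variable {V : Type*} [NormedAddCommGroup V] [InnerProductSpace ℝ V]

theorem sum_lower_triangle_inner (N : ℕ) (M A : ℕ → ℕ → ℝ) (r : ℕ → ℝ) (x g : ℕ → V) (y0 : V)
    (hsym : ∀ i j, M i j = M j i)
    (hrow : ∀ k ∈ Finset.Icc 1 N, ∑ j ∈ Finset.Icc 1 N, M k j = r k)
    (hz : ∀ k ∈ Finset.Icc 1 N, x k - y0 = -g k - ∑ i ∈ Finset.Icc 1 N, (2 * A k i) • g i) :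
    ∑ k ∈ Finset.Icc 1 N, ∑ j ∈ Finset.Icc 1 (k - 1), -M k j * ⟪x k - x j, g k - g j⟫ =
      -(∑ k ∈ Finset.Icc 1 N, r k * ⟪x k - y0, g k⟫) -
        ∑ i ∈ Finset.Icc 1 N, ∑ j ∈ Finset.Icc 1 N, (M i j +
          ∑ l ∈ Finset.Icc 1 N, M i l * A l j + ∑ l ∈ Finset.Icc 1 N, A l i * M l j) *
            ⟪g i, g j⟫ := by
  have htri := two_mul_sum_lower_triangle N (fun k j => -M k j * ⟪x k - x j, g k - g j⟫)
    (fun i j => by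
      rw [hsym i j, ← neg_sub (x j), ← neg_sub (g j), inner_neg_neg]) (fun i => by simp)
  have hexp : ∀ k j, -M k j * ⟪x k - x j, g k - g j⟫ =
      -(M k j * ⟪x k - y0, g k⟫) + M k j * ⟪x k - y0, g j⟫ -
        M k j * ⟪x j - y0, g j⟫ + M k j * ⟪x j - y0, g k⟫ := by
    intro k j
    rw [← sub_sub_sub_cancel_right (x k) (x j) y0]
    generalize x k - y0 = a
    generalize x j - y0 = b
    simp only [inner_sub_left, inner_sub_right]
    ring
  have hdiag : ∑ k ∈ Finset.Icc 1 N, ∑ j ∈ Finset.Icc 1 N, M k j * ⟪x k - y0, g k⟫ =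
      ∑ k ∈ Finset.Icc 1 N, r k * ⟪x k - y0, g k⟫ :=
    Finset.sum_congr rfl fun k hk => by rw [← Finset.sum_mul, hrow k hk]
  have hdiag' : ∑ k ∈ Finset.Icc 1 N, ∑ j ∈ Finset.Icc 1 N, M k j * ⟪x j - y0, g j⟫ =
      ∑ k ∈ Finset.Icc 1 N, r k * ⟪x k - y0, g k⟫ := by
    rw [Finset.sum_comm, ← hdiag]
    exact Finset.sum_congr rfl fun k _ => Finset.sum_congr rfl fun j _ => by rw [hsym]
  have hcross : ∑ k ∈ Finset.Icc 1 N, ∑ j ∈ Finset.Icc 1 N, M k j * ⟪x j - y0, g k⟫ =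
      ∑ k ∈ Finset.Icc 1 N, ∑ j ∈ Finset.Icc 1 N, M k j * ⟪x k - y0, g j⟫ := by
    rw [Finset.sum_comm]
    exact Finset.sum_congr rfl fun k _ => Finset.sum_congr rfl fun j _ => by rw [hsym]
  have hAM : ∑ k ∈ Finset.Icc 1 N, ∑ j ∈ Finset.Icc 1 N, M k j * ⟪x k - y0, g j⟫ =
      -(∑ i ∈ Finset.Icc 1 N, ∑ j ∈ Finset.Icc 1 N, M i j * ⟪g i, g j⟫) -
        2 * ∑ i ∈ Finset.Icc 1 N, ∑ j ∈ Finset.Icc 1 N,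
          (∑ l ∈ Finset.Icc 1 N, A l i * M l j) * ⟪g i, g j⟫ := by
    have h1 : ∀ k ∈ Finset.Icc 1 N, ∀ j, M k j * ⟪x k - y0, g j⟫ =
        -(M k j * ⟪g k, g j⟫) - 2 * ∑ i ∈ Finset.Icc 1 N, A k i * M k j * ⟪g i, g j⟫ := by
      intro k hk j
      rw [hz k hk, inner_sub_left, inner_neg_left, sum_inner, mul_sub, Finset.mul_sum,
        Finset.mul_sum, mul_neg]
      congr 1
      refine Finset.sum_congr rfl fun i _ => ?_
      rw [real_inner_smul_left]
      ring
    rw [Finset.sum_congr rfl fun k hk => Finset.sum_congr rfl fun j _ => h1 k hk j]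
    simp only [Finset.sum_sub_distrib, Finset.sum_neg_distrib, ← Finset.mul_sum]
    congr 2
    simp only [Finset.sum_mul]
    rw [Finset.sum_comm' (t' := Finset.Icc 1 N) (s' := fun _ => Finset.Icc 1 N) (by tauto),
      Finset.sum_comm (s := Finset.Icc 1 N) (t := Finset.Icc 1 N)
        (f := fun i j => ∑ l ∈ Finset.Icc 1 N, A l i * M l j * ⟪g i, g j⟫)]
    refine Finset.sum_congr rfl fun j _ => ?_
    rw [Finset.sum_comm]
  have hMA : ∑ i ∈ Finset.Icc 1 N, ∑ j ∈ Finset.Icc 1 N,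
        (∑ l ∈ Finset.Icc 1 N, M i l * A l j) * ⟪g i, g j⟫ =
      ∑ i ∈ Finset.Icc 1 N, ∑ j ∈ Finset.Icc 1 N,
        (∑ l ∈ Finset.Icc 1 N, A l i * M l j) * ⟪g i, g j⟫ := by
    rw [Finset.sum_comm]
    refine Finset.sum_congr rfl fun i _ => Finset.sum_congr rfl fun j _ => ?_
    rw [real_inner_comm]
    congr 1
    exact Finset.sum_congr rfl fun l _ => by rw [hsym, mul_comm]
  simp only [hexp] at htri ⊢
  simp only [Finset.sum_add_distrib, Finset.sum_sub_distrib, Finset.sum_neg_distrib, hdiag,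
    hdiag', hcross, add_mul, hMA] at htri ⊢
  linarith

theorem sub_initial_eq (N : ℕ) (H : ℕ → ℕ → ℝ) (y0 : V) (g y x : ℕ → V) (h0 : y 0 = y0)
    (hy : ∀ i, 1 ≤ i → i ≤ N - 1 →
      y i = y (i - 1) - ∑ j ∈ Finset.Icc 1 i, (2 * H i j) • g j)
    (hx : ∀ i, 1 ≤ i → i ≤ N → x i = y (i - 1) - g i) :
    ∀ k ∈ Finset.Icc 1 N,
      x k - y0 = -g k - ∑ i ∈ Finset.Icc 1 N, (2 * partialColSum H k i) • g i := by
  have key : ∀ k, k < N →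
      y k = y0 - ∑ i ∈ Finset.Icc 1 N, (2 * partialColSum H (k + 1) i) • g i := by
    intro k
    induction k with
    | zero =>
      intro _
      rw [Finset.sum_eq_zero, sub_zero, h0]
      intro i hi
      rw [partialColSum_eq_zero H (Finset.mem_Icc.1 hi).1, mul_zero, zero_smul]
    | succ k ih =>
      intro hk
      have hsub : ∑ j ∈ Finset.Icc 1 (k + 1), (2 * H (k + 1) j) • g j =
          ∑ j ∈ Finset.Icc 1 N, (if j ≤ k + 1 then 2 * H (k + 1) j else 0) • g j := by
        rw [← Finset.sum_subset (Finset.Icc_subset_Icc_right hk.le)]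
        · exact Finset.sum_congr rfl fun j hj => by rw [if_pos (Finset.mem_Icc.1 hj).2]
        · intro j hj hj'
          rw [if_neg, zero_smul]
          simp only [Finset.mem_Icc] at hj hj'
          omega
      rw [hy (k + 1) (by omega) (by omega), Nat.add_sub_cancel, ih (by omega), hsub, sub_sub,
        ← Finset.sum_add_distrib]
      congr 1
      refine Finset.sum_congr rfl fun j _ => ?_
      rw [← add_smul]
      congr 1
      split_ifs with h
      · rw [partialColSum, partialColSum, Finset.sum_Ico_succ_top h]
        ring
      · rw [partialColSum_eq_zero H (by omega), partialColSum_eq_zero H (by omega)]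
        ring
  intro k hk
  rw [Finset.mem_Icc] at hk
  rw [hx k hk.1 hk.2, key (k - 1) (by omega), Nat.sub_add_cancel hk.1]
  abel

theorem certificate_residual (N : ℕ) (hN : 1 ≤ N) (H M lam : ℕ → ℕ → ℝ)
    (hsym : ∀ i j, M i j = M j i)
    (hrow : ∀ k ∈ Finset.Icc 1 N, ∑ j ∈ Finset.Icc 1 N, M k j = if k = N then 1 else 0)
    (hlam : ∀ k j, 1 ≤ j → j < k → k ≤ N → lam k j = -M k j) (y0 : V) (g y x : ℕ → V)
    (h0 : y 0 = y0)
    (hy : ∀ i, 1 ≤ i → i ≤ N - 1 →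
      y i = y (i - 1) - ∑ j ∈ Finset.Icc 1 i, (2 * H i j) • g j)
    (hx : ∀ i, 1 ≤ i → i ≤ N → x i = y (i - 1) - g i) :
    (N : ℝ) * ‖g N‖ ^ 2 + ⟪g N, x N - y0⟫ +
        ∑ k ∈ Finset.Icc 1 N, ∑ j ∈ Finset.Icc 1 (k - 1), lam k j * ⟪x k - x j, g k - g j⟫ =
      -∑ i ∈ Finset.Icc 1 N, ∑ j ∈ Finset.Icc 1 N, (M i j +
          ∑ l ∈ Finset.Icc 1 N, M i l * partialColSum H l j +
          ∑ l ∈ Finset.Icc 1 N, partialColSum H l i * M l j -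
          if i = N ∧ j = N then (N : ℝ) else 0) * ⟪g i, g j⟫ := by
  have hmem : N ∈ Finset.Icc 1 N := Finset.mem_Icc.2 ⟨hN, le_rfl⟩
  have hs : ∑ k ∈ Finset.Icc 1 N, ∑ j ∈ Finset.Icc 1 (k - 1), lam k j * ⟪x k - x j, g k - g j⟫ =
      ∑ k ∈ Finset.Icc 1 N, ∑ j ∈ Finset.Icc 1 (k - 1), -M k j * ⟪x k - x j, g k - g j⟫ := by
    refine Finset.sum_congr rfl fun k hk => Finset.sum_congr rfl fun j hj => ?_
    rw [Finset.mem_Icc] at hk hj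
    rw [hlam k j hj.1 (by omega) hk.2]
  rw [hs, sum_lower_triangle_inner N M (partialColSum H) _ x g y0 hsym hrow
    (sub_initial_eq N H y0 g y x h0 hy hx)]
  have h1 : ∑ k ∈ Finset.Icc 1 N, (if k = N then (1 : ℝ) else 0) * ⟪x k - y0, g k⟫ =
      ⟪g N, x N - y0⟫ := by
    simp only [ite_mul, one_mul, zero_mul]
    rw [Finset.sum_ite_eq' (Finset.Icc 1 N), if_pos hmem, real_inner_comm]
  have h2 : ∑ i ∈ Finset.Icc 1 N, ∑ j ∈ Finset.Icc 1 N,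
      (if i = N ∧ j = N then (N : ℝ) else 0) * ⟪g i, g j⟫ = (N : ℝ) * ‖g N‖ ^ 2 := by
    simp only [ite_and, ite_mul, zero_mul]
    simp only [Finset.sum_ite_irrel, Finset.sum_const_zero]
    rw [Finset.sum_ite_eq' (Finset.Icc 1 N), if_pos hmem, Finset.sum_ite_eq' (Finset.Icc 1 N),
      if_pos hmem, real_inner_self_eq_norm_sq]
  simp only [sub_mul, Finset.sum_sub_distrib, h1, h2]
  ring

theorem hcertificate_identity (N : ℕ) (hN : 1 ≤ N) (H : ℕ → ℕ → ℝ)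
    (hinv : ∀ m, 1 ≤ m → m ≤ N - 1 →
      Pinv H (N - 1) m = 1 / (N : ℝ) * (Nat.choose N (m + 1) : ℝ))
    (y0 : V) (g y x : ℕ → V) (h0 : y 0 = y0)
    (hy : ∀ i, 1 ≤ i → i ≤ N - 1 →
      y i = y (i - 1) - ∑ j ∈ Finset.Icc 1 i, (2 * H i j) • g j)
    (hx : ∀ i, 1 ≤ i → i ≤ N → x i = y (i - 1) - g i) :
    (0 : ℝ) = (N : ℝ) * ‖g N‖ ^ 2 + ⟪g N, x N - y0⟫ +
      ∑ k ∈ Finset.Icc 1 N, ∑ j ∈ Finset.Icc 1 (k - 1),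
        lamStar N H k j * ⟪x k - x j, g k - g j⟫ := by
  rw [certificate_residual N hN H (lyapunovSol N H) (lamStar N H) (lyapunovSol_comm N H)
    (fun k _ => sum_lyapunovSol N hN H hinv k) (lamStar_eq_neg_lyapunovSol N H) y0 g y x h0 hy hx,
    eq_comm, neg_eq_zero]
  refine Finset.sum_eq_zero fun i hi => Finset.sum_eq_zero fun j hj => ?_
  rw [lyapunovSol_equation N hN H i j (Finset.mem_Icc.1 hi).1 (Finset.mem_Icc.1 hj).1, sub_self,
    zero_mul]

end InnerProduct

theorem eq_zero_of_quadratic_form_eq_zero (s : Finset ℕ) (G : ℕ → ℕ → ℝ)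
    (hsym : ∀ i j, G i j = G j i)
    (h : ∀ a : ℕ → ℝ, ∑ i ∈ s, ∑ j ∈ s, G i j * (a i * a j) = 0) :
    ∀ p ∈ s, ∀ q ∈ s, G p q = 0 := by
  intro p hp q hq
  have hbil : ∀ p ∈ s, ∀ q ∈ s, ∑ i ∈ s, ∑ j ∈ s,
      G i j * ((Pi.single p 1 : ℕ → ℝ) i * (Pi.single q 1 : ℕ → ℝ) j) = G p q := by
    intro p hp q hq
    rw [Finset.sum_eq_single_of_mem p hp, Finset.sum_eq_single_of_mem q hq]
    · simp
    · intro j _ hj; simp [Pi.single_eq_of_ne hj]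
    · intro i _ hi; simp [Pi.single_eq_of_ne hi]
  have hpp := h (Pi.single p 1)
  have hqq := h (Pi.single q 1)
  have hpq := h (Pi.single p 1 + Pi.single q 1)
  simp only [Pi.add_apply, add_mul, mul_add, Finset.sum_add_distrib] at hpq
  rw [hbil p hp p hp] at hpp hpq
  rw [hbil q hq q hq] at hqq hpq
  rw [hbil p hp q hq, hbil q hq p hp, hsym q p] at hpq
  linarith

theorem hcertificate_unique (N : ℕ) (hN : 1 ≤ N) (H : ℕ → ℕ → ℝ) (lam : ℕ → ℕ → ℝ)
    (hlam : ∀ (y0 : EuclideanSpace ℝ (Fin (N + 1))) (g y x : ℕ → EuclideanSpace ℝ (Fin (N + 1))),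
        y 0 = y0 →
        (∀ i, 1 ≤ i → i ≤ N - 1 →
          y i = y (i - 1) - ∑ j ∈ Finset.Icc 1 i, (2 * H i j) • g j) →
        (∀ i, 1 ≤ i → i ≤ N → x i = y (i - 1) - g i) →
        (0 : ℝ) = (N : ℝ) * ‖g N‖ ^ 2 + ⟪g N, x N - y0⟫ +
          ∑ k ∈ Finset.Icc 1 N, ∑ j ∈ Finset.Icc 1 (k - 1),
            lam k j * ⟪x k - x j, g k - g j⟫) :
    ∀ k j, 1 ≤ j → j < k → k ≤ N → lam k j = lamStar N H k j := by
  let L : ℕ → ℕ → ℝ := fun i j => lam (max i j) (min i j)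
  have hL : ∀ i j, L i j = L j i := fun i j => by simp only [L, max_comm, min_comm]
  let M : ℕ → ℕ → ℝ := fun i j =>
    if i = j then (if i = N then 1 else 0) + ∑ l ∈ (Finset.Icc 1 N).erase i, L i l else -L i j
  have hsym : ∀ i j, M i j = M j i := by
    intro i j
    by_cases h : i = j
    · rw [h]
    · simp only [M, if_neg h, if_neg (Ne.symm h), hL i j]
  have hrow : ∀ k ∈ Finset.Icc 1 N, ∑ j ∈ Finset.Icc 1 N, M k j = if k = N then 1 else 0 := by
    intro k hk
    rw [← Finset.add_sum_erase _ _ hk]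
    have h : ∑ j ∈ (Finset.Icc 1 N).erase k, M k j =
        -∑ j ∈ (Finset.Icc 1 N).erase k, L k j := by
      rw [← Finset.sum_neg_distrib]
      exact Finset.sum_congr rfl fun j hj => if_neg (Ne.symm (Finset.ne_of_mem_erase hj))
    rw [h]
    simp only [M, if_true]
    ring
  have hM : ∀ k j, 1 ≤ j → j < k → k ≤ N → lam k j = -M k j := by
    intro k j _ hjk _
    simp only [M, L, if_neg hjk.ne', neg_neg, max_eq_left hjk.le, min_eq_right hjk.le]
  let E : ℕ → ℕ → ℝ := fun i j => M i j +
    ∑ l ∈ Finset.Icc 1 N, M i l * partialColSum H l j +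
    ∑ l ∈ Finset.Icc 1 N, partialColSum H l i * M l j - if i = N ∧ j = N then (N : ℝ) else 0
  have hEsym : ∀ i j, E i j = E j i := by
    intro i j
    have h1 : ∀ i j, ∑ l ∈ Finset.Icc 1 N, M i l * partialColSum H l j =
        ∑ l ∈ Finset.Icc 1 N, partialColSum H l j * M l i := fun i j =>
      Finset.sum_congr rfl fun l _ => by rw [hsym, mul_comm]
    simp only [E, h1, hsym i j, and_comm (a := i = N)]
    ring
  have hE : ∀ i ∈ Finset.Icc 1 N, ∀ j ∈ Finset.Icc 1 N, E i j = 0 := by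
    refine eq_zero_of_quadratic_form_eq_zero _ E hEsym fun a => ?_
    let e : EuclideanSpace ℝ (Fin (N + 1)) := EuclideanSpace.single 0 1
    let g : ℕ → EuclideanSpace ℝ (Fin (N + 1)) := fun i => a i • e
    let y : ℕ → EuclideanSpace ℝ (Fin (N + 1)) := fun i =>
      -∑ t ∈ Finset.Icc 1 i, ∑ j ∈ Finset.Icc 1 t, (2 * H t j) • g j
    have h0 : y 0 = 0 := by simp [y]
    have hy : ∀ i, 1 ≤ i → i ≤ N - 1 →
        y i = y (i - 1) - ∑ j ∈ Finset.Icc 1 i, (2 * H i j) • g j := by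
      intro i hi _
      obtain ⟨i, rfl⟩ : ∃ i', i = i' + 1 := ⟨i - 1, by omega⟩
      simp only [y, Nat.add_sub_cancel]
      rw [Finset.sum_Icc_succ_top (by omega)]
      abel
    have hx : ∀ i, 1 ≤ i → i ≤ N → y (i - 1) - g i = y (i - 1) - g i := fun _ _ _ => rfl
    have h := hlam 0 g y (fun i => y (i - 1) - g i) h0 hy hx
    rw [certificate_residual N hN H M lam hsym hrow hM 0 g y (fun i => y (i - 1) - g i) h0 hy hx,
      eq_comm, neg_eq_zero] at h
    rw [← h]
    refine Finset.sum_congr rfl fun i _ => Finset.sum_congr rfl fun j _ => ?_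
    have he : ⟪g i, g j⟫ = a i * a j := by
      simp only [g, real_inner_smul_left, real_inner_smul_right]
      simp [e, mul_comm]
    rw [he]
  have hD := lyapunov_unique N (partialColSum H) (fun i j => M i j - lyapunovSol N H i j)
    (fun i j h => partialColSum_eq_zero H h) (by
      intro i hi j hj
      have h1 := hE i hi j hj
      have h2 := lyapunovSol_equation N hN H i j (Finset.mem_Icc.1 hi).1 (Finset.mem_Icc.1 hj).1
      simp only [E] at h1
      simp only [sub_mul, mul_sub, Finset.sum_sub_distrib]
      linarith)
  intro k j hj hjk hk
  rw [hM k j hj hjk hk, lamStar_eq_neg_lyapunovSol N H k j hj hjk hk,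
    sub_eq_zero.1 (hD k (Finset.mem_Icc.2 (by omega)) j (Finset.mem_Icc.2 (by omega)))]

/-- **The H-certificate identity and its uniqueness (Theorem 5.2 / identity (8)).**
Under H-invariance, for every real inner product space `V`, every `y₀ ∈ V` and all
`g₁,…,g_N ∈ V`, with `y_i = y_{i−1} − Σ_{j=1}^{i} 2h_{i,j}·g_j` (`i = 1,…,N−1`) and
`x_i = y_{i−1} − g_i` (`i = 1,…,N`), the identity
`0 = N‖g_N‖² + ⟨g_N, x_N − y₀⟩ + Σ_{k=1}^{N} Σ_{j=1}^{k−1} λ*_{k,j}(H)·⟨x_k − x_j, g_k − g_j⟩`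
holds; moreover `λ*` is the unique family of coefficients for which this identity holds for
all choices of `y₀, g₁,…,g_N ∈ ℝ^{N+1}`. -/
theorem hcertificate_identity_and_uniqueness.{u} (N : ℕ) (hN : 2 ≤ N) (H : ℕ → ℕ → ℝ)
    (hinv : ∀ m, 1 ≤ m → m ≤ N - 1 →
      Pinv H (N - 1) m = 1 / (N : ℝ) * (Nat.choose N (m + 1) : ℝ)) :
    (∀ (V : Type u) [NormedAddCommGroup V] [InnerProductSpace ℝ V],
      ∀ (y0 : V) (g y x : ℕ → V),
        y 0 = y0 →
        (∀ i, 1 ≤ i → i ≤ N - 1 →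
          y i = y (i - 1) - ∑ j ∈ Finset.Icc 1 i, (2 * H i j) • g j) →
        (∀ i, 1 ≤ i → i ≤ N → x i = y (i - 1) - g i) →
        (0 : ℝ) = (N : ℝ) * ‖g N‖ ^ 2 + ⟪g N, x N - y0⟫ +
          ∑ k ∈ Finset.Icc 1 N, ∑ j ∈ Finset.Icc 1 (k - 1),
            lamStar N H k j * ⟪x k - x j, g k - g j⟫) ∧
    (∀ lam : ℕ → ℕ → ℝ,
      (∀ (y0 : EuclideanSpace ℝ (Fin (N + 1))) (g y x : ℕ → EuclideanSpace ℝ (Fin (N + 1))),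
        y 0 = y0 →
        (∀ i, 1 ≤ i → i ≤ N - 1 →
          y i = y (i - 1) - ∑ j ∈ Finset.Icc 1 i, (2 * H i j) • g j) →
        (∀ i, 1 ≤ i → i ≤ N → x i = y (i - 1) - g i) →
        (0 : ℝ) = (N : ℝ) * ‖g N‖ ^ 2 + ⟪g N, x N - y0⟫ +
          ∑ k ∈ Finset.Icc 1 N, ∑ j ∈ Finset.Icc 1 (k - 1),
            lam k j * ⟪x k - x j, g k - g j⟫) →
      ∀ k j, 1 ≤ j → j < k → k ≤ N → lam k j = lamStar N H k j) := by
  exact ⟨fun V _ _ y0 g y x => hcertificate_identity N (by omega) H hinv y0 g y x,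
    hcertificate_unique N (by omega) H⟩
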